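/- arXiv:2409.20505 — 3 statements merged into one kernel-verified Lean document; each statement's English description precedes it below -/
import Mathlib

section
/- Let G and H be connected simple graphs, let S_1 ⊆ V(G), S_2 ⊆ V(H), and let S = S_1 × S_2 ⊆ V(G □ H). Then for every vertex (u,v) of the Cartesian product G □ H: (u,v) belongs to the geodetic closure of S in G □ H if and only if u belongs to the geodetic closure of S_1 in G and v belongs to the geodetic closure of S_2 in H. -/
open SimpleGraph

/-- mex: least nonnegative integer not in the set. -/
noncomputable def mex (X : Set ℕ) : ℕ := sInf Xᶜ

/-- The interval `I(u,v)`: vertices on some shortest `u`–`v` path. -/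
def geodInterval {V : Type*} (G : SimpleGraph V) (u v : V) : Set V :=
  {w | G.dist u w + G.dist w v = G.dist u v}

/-- The geodetic closure `(S)`. -/
def geodClosure {V : Type*} (G : SimpleGraph V) (S : Set V) : Set V :=
  ⋃ u ∈ S, ⋃ v ∈ S, geodInterval G u v

/-- Sprague–Grundy value of the Closed Geodetic Game on `G` with selected set `S`. -/
noncomputable def grundy {V : Type*} [Fintype V] [DecidableEq V]
    (G : SimpleGraph V) (S : Finset V) : ℕ :=
  mex (Set.range fun v : {v : V // v ∉ geodClosure G ↑S} =>
    grundy G (insert v.1 S))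
termination_by Sᶜ.card
decreasing_by
  have hv : (v : V) ∉ S := by
    intro h
    exact v.2 (Set.mem_biUnion (by simpa using h)
      (Set.mem_biUnion (by simpa using h) (by simp [geodInterval])))
  simp only [Finset.compl_insert]
  exact Finset.card_erase_lt_of_mem (by simpa using hv)

/-- In a box product of connected graphs, distances add up coordinatewise. -/
theorem dist_boxProd_of_connected {V W : Type*} {G : SimpleGraph V} {H : SimpleGraph W}
    (hG : G.Connected) (hH : H.Connected) (x y : V × W) :
    (G □ H).dist x y = G.dist x.1 y.1 + H.dist x.2 y.2 := by
  simp only [SimpleGraph.dist, SimpleGraph.edist_boxProd]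
  exact ENat.toNat_add (SimpleGraph.edist_ne_top_iff_reachable.2 (hG x.1 y.1))
    (SimpleGraph.edist_ne_top_iff_reachable.2 (hH x.2 y.2))

/-- Intervals in a box product of connected graphs are products of intervals. -/
theorem geodInterval_boxProd {V W : Type*} {G : SimpleGraph V} {H : SimpleGraph W}
    (hG : G.Connected) (hH : H.Connected) (x y : V × W) :
    geodInterval (G □ H) x y = geodInterval G x.1 y.1 ×ˢ geodInterval H x.2 y.2 := by
  ext z
  have h₁ := hG.dist_triangle (u := x.1) (v := z.1) (w := y.1)
  have h₂ := hH.dist_triangle (u := x.2) (v := z.2) (w := y.2)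
  simp only [geodInterval, Set.mem_prod, Set.mem_ofPred_eq, dist_boxProd_of_connected hG hH]
  omega

theorem mem_geodClosure {V : Type*} {G : SimpleGraph V} {S : Set V} {w : V} :
    w ∈ geodClosure G S ↔ ∃ u ∈ S, ∃ v ∈ S, w ∈ geodInterval G u v := by
  simp [geodClosure]

/-- the geodetic closure of a product set in a box product is the
product of the geodetic closures. -/
theorem boxProd_geodClosure {V W : Type*} (G : SimpleGraph V) (H : SimpleGraph W)
    (hG : G.Connected) (hH : H.Connected) (S₁ : Set V) (S₂ : Set W) (u : V) (v : W) :
    (u, v) ∈ geodClosure (G □ H) (S₁ ×ˢ S₂) ↔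
      u ∈ geodClosure G S₁ ∧ v ∈ geodClosure H S₂ := by
  simp only [mem_geodClosure, geodInterval_boxProd hG hH]
  constructor
  · rintro ⟨x, hx, y, hy, hu, hv⟩
    exact ⟨⟨x.1, hx.1, y.1, hy.1, hu⟩, ⟨x.2, hx.2, y.2, hy.2, hv⟩⟩
  · rintro ⟨⟨a, ha, c, hc, hu⟩, ⟨b, hb, d, hd, hv⟩⟩
    exact ⟨(a, b), ⟨ha, hb⟩, (c, d), ⟨hc, hd⟩, hu, hv⟩
end

section
/- For every positive integer n, the Sprague–Grundy value of the Closed Geodetic Game on the star K_{1,n} (one centre vertex c adjacent to n leaves, no other edges) is 𝒢(K_{1,n}) = 1 − (n mod 2). -/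
open SimpleGraph

theorem mex_eq {X : Set ℕ} {m : ℕ} (hm : m ∉ X) (h : ∀ k < m, k ∈ X) : mex X = m := by
  apply le_antisymm
  · exact Nat.sInf_le hm
  · refine le_csInf ⟨m, hm⟩ fun b hb => ?_
    by_contra hlt
    exact hb (h b (not_le.mp hlt))

theorem grundy_eq {V : Type*} [Fintype V] [DecidableEq V] {G : SimpleGraph V} {S : Finset V}
    {m : ℕ} (hm : ∀ v ∉ geodClosure G (S : Set V), grundy G (insert v S) ≠ m)
    (h : ∀ k < m, ∃ v ∉ geodClosure G (S : Set V), grundy G (insert v S) = k) :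
    grundy G S = m := by
  rw [grundy]
  apply mex_eq
  · rintro ⟨⟨v, hv⟩, hvm⟩
    exact hm v hv hvm
  · intro k hk
    obtain ⟨v, hv, hvk⟩ := h k hk
    exact ⟨⟨v, hv⟩, hvk⟩

section Star

variable {n : ℕ}

theorem star_dist_inl_inr (a : Fin 1) (i : Fin n) :
    (completeBipartiteGraph (Fin 1) (Fin n)).dist (.inl a) (.inr i) = 1 := by
  rw [dist_eq_one_iff_adj]
  simp [completeBipartiteGraph]

theorem star_dist_inr_inl (a : Fin 1) (i : Fin n) :
    (completeBipartiteGraph (Fin 1) (Fin n)).dist (.inr i) (.inl a) = 1 := by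
  rw [dist_comm, star_dist_inl_inr]

theorem star_dist_inr_inr {i j : Fin n} (h : i ≠ j) :
    (completeBipartiteGraph (Fin 1) (Fin n)).dist (.inr i) (.inr j) = 2 := by
  have h₁ : (completeBipartiteGraph (Fin 1) (Fin n)).Adj (.inr i) (.inl 0) := by
    simp [completeBipartiteGraph]
  have h₂ : (completeBipartiteGraph (Fin 1) (Fin n)).Adj (.inl 0) (.inr j) := by
    simp [completeBipartiteGraph]
  have hle := dist_le (Walk.cons h₁ (Walk.cons h₂ Walk.nil))
  simp only [Walk.length_cons, Walk.length_nil] at hle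
  have hr : (completeBipartiteGraph (Fin 1) (Fin n)).Reachable (.inr i) (.inr j) :=
    ⟨Walk.cons h₁ (Walk.cons h₂ Walk.nil)⟩
  have hpos := hr.pos_dist_of_ne (by simpa using h)
  have hne : (completeBipartiteGraph (Fin 1) (Fin n)).dist (.inr i) (.inr j) ≠ 1 := by
    rw [Ne, dist_eq_one_iff_adj]
    simp [completeBipartiteGraph]
  omega

theorem inr_mem_geodClosure_star {S : Set (Fin 1 ⊕ Fin n)} {i : Fin n} :
    Sum.inr i ∈ geodClosure (completeBipartiteGraph (Fin 1) (Fin n)) S ↔ Sum.inr i ∈ S := by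
  simp only [geodClosure, geodInterval, Set.mem_iUnion, Set.mem_ofPred_eq, exists_prop]
  constructor
  · rintro ⟨u, hu, v, hv, h⟩
    by_contra hi
    rcases u with a | u <;> rcases v with b | v
    · obtain rfl := Subsingleton.elim a b
      simp [star_dist_inl_inr] at h
    · have : i ≠ v := by rintro rfl; exact hi hv
      simp [star_dist_inl_inr, star_dist_inr_inr this] at h
    · have : u ≠ i := by rintro rfl; exact hi hu
      simp [star_dist_inr_inl, star_dist_inr_inr this] at h
    · have h₁ : u ≠ i := by rintro rfl; exact hi hu
      have h₂ : i ≠ v := by rintro rfl; exact hi hv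
      rw [star_dist_inr_inr h₁, star_dist_inr_inr h₂] at h
      by_cases huv : u = v
      · subst huv
        simp at h
      · rw [star_dist_inr_inr huv] at h
        omega
  · exact fun h => ⟨_, h, _, h, by simp⟩

theorem inl_mem_geodClosure_star {S : Set (Fin 1 ⊕ Fin n)} {a : Fin 1} :
    Sum.inl a ∈ geodClosure (completeBipartiteGraph (Fin 1) (Fin n)) S ↔
      Sum.inl a ∈ S ∨ ∃ i j, i ≠ j ∧ Sum.inr i ∈ S ∧ Sum.inr j ∈ S := by
  simp only [geodClosure, geodInterval, Set.mem_iUnion, Set.mem_ofPred_eq, exists_prop]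
  constructor
  · rintro ⟨u, hu, v, hv, h⟩
    rcases u with b | u
    · obtain rfl := Subsingleton.elim a b
      exact .inl hu
    rcases v with b | v
    · obtain rfl := Subsingleton.elim a b
      exact .inl hv
    refine .inr ⟨u, v, ?_, hu, hv⟩
    rintro rfl
    simp [star_dist_inl_inr, star_dist_inr_inl] at h
  · rintro (h | ⟨i, j, hij, hi, hj⟩)
    · exact ⟨_, h, _, h, by simp⟩
    · exact ⟨_, hi, _, hj, by rw [star_dist_inl_inr, star_dist_inr_inl, star_dist_inr_inr hij]⟩

/-- Once the centre of the star is covered, the game is played on the unselected leaves only. -/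
theorem grundy_star_of_inl_mem (m : ℕ) (S : Finset (Fin 1 ⊕ Fin n))
    (hS : Sum.inl 0 ∈ geodClosure (completeBipartiteGraph (Fin 1) (Fin n)) (S : Set _))
    (hm : (Finset.univ.filter fun i : Fin n => Sum.inr i ∉ S).card = m) :
    grundy (completeBipartiteGraph (Fin 1) (Fin n)) S = m % 2 := by
  induction m generalizing S with
  | zero =>
    refine grundy_eq (fun v hv => ?_) (by simp)
    rcases v with a | i
    · exact absurd (Subsingleton.elim 0 a ▸ hS) hv
    · rw [inr_mem_geodClosure_star, Finset.mem_coe] at hv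
      have := Finset.card_eq_zero.mp hm
      exact absurd (this ▸ Finset.mem_filter.mpr ⟨Finset.mem_univ i, hv⟩) (by simp)
  | succ m ih =>
    have key (i : Fin n) (hi : Sum.inr i ∉ S) :
        grundy (completeBipartiteGraph (Fin 1) (Fin n)) (insert (Sum.inr i) S) = m % 2 := by
      apply ih
      · rw [inl_mem_geodClosure_star] at hS ⊢
        simp only [Finset.mem_coe, Finset.mem_insert] at hS ⊢
        grind
      · have : (Finset.univ.filter fun j : Fin n => Sum.inr j ∉ insert (Sum.inr i) S) =
            (Finset.univ.filter fun j : Fin n => Sum.inr j ∉ S).erase i := by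
          ext j
          simp
        rw [this, Finset.card_erase_of_mem (by simpa using hi), hm, Nat.add_sub_cancel]
    refine grundy_eq (fun v hv => ?_) fun k hk => ?_
    · rcases v with a | i
      · exact absurd (Subsingleton.elim 0 a ▸ hS) hv
      · rw [inr_mem_geodClosure_star, Finset.mem_coe] at hv
        rw [key i hv]
        omega
    · obtain ⟨i, hi⟩ := Finset.card_pos.mp (hm.symm ▸ Nat.succ_pos m :
        0 < (Finset.univ.filter fun i : Fin n => Sum.inr i ∉ S).card)
      have hi' : Sum.inr i ∉ S := (Finset.mem_filter.mp hi).2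
      refine ⟨Sum.inr i, ?_, ?_⟩
      · rwa [inr_mem_geodClosure_star, Finset.mem_coe]
      · rw [key i hi']
        omega

theorem grundy_star_center :
    grundy (completeBipartiteGraph (Fin 1) (Fin n)) {Sum.inl 0} = n % 2 :=
  grundy_star_of_inl_mem n _ (by simp [inl_mem_geodClosure_star]) (by simp)

theorem grundy_star_center_leaf (i : Fin n) :
    grundy (completeBipartiteGraph (Fin 1) (Fin n)) {Sum.inl 0, Sum.inr i} = (n - 1) % 2 := by
  refine grundy_star_of_inl_mem _ _ (by simp [inl_mem_geodClosure_star]) ?_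
  simp [Finset.filter_ne']

theorem grundy_star_leaf_leaf {i j : Fin n} (h : i ≠ j) :
    grundy (completeBipartiteGraph (Fin 1) (Fin n)) {Sum.inr j, Sum.inr i} = n % 2 := by
  rw [grundy_star_of_inl_mem (n - 2) _ ?_ ?_]
  · have := i.2
    have := j.2
    have : i.1 ≠ j.1 := Fin.val_ne_of_ne h
    omega
  · rw [inl_mem_geodClosure_star]
    exact .inr ⟨i, j, h, by simp, by simp⟩
  · have : (Finset.univ.filter fun k : Fin n =>
        Sum.inr k ∉ ({Sum.inr j, Sum.inr i} : Finset (Fin 1 ⊕ Fin n))) = {j, i}ᶜ := by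
      ext k
      simp
    rw [this, Finset.card_compl, Finset.card_pair h.symm, Fintype.card_fin]

theorem grundy_star_leaf (i : Fin n) :
    grundy (completeBipartiteGraph (Fin 1) (Fin n)) {Sum.inr i} = if n = 1 then 1 else 2 := by
  have hn := i.pos
  have hc : Sum.inl 0 ∉ geodClosure (completeBipartiteGraph (Fin 1) (Fin n))
      (({Sum.inr i} : Finset (Fin 1 ⊕ Fin n)) : Set _) := by
    simp only [inl_mem_geodClosure_star, Finset.mem_coe, Finset.mem_singleton]
    grind
  refine grundy_eq (fun v hv => ?_) fun k hk => ?_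
  · rcases v with a | j
    · obtain rfl := Subsingleton.elim 0 a
      rw [grundy_star_center_leaf]
      split_ifs <;> omega
    · have hij : i ≠ j := by
        rintro rfl
        simp [inr_mem_geodClosure_star] at hv
      rw [grundy_star_leaf_leaf hij]
      have := i.2
      have := j.2
      have : i.1 ≠ j.1 := Fin.val_ne_of_ne hij
      split_ifs <;> omega
  · by_cases hk' : (n - 1) % 2 = k
    · exact ⟨_, hc, by rw [grundy_star_center_leaf, hk']⟩
    · have hn1 : n ≠ 1 := by
        rintro rfl
        simp at hk
        omega
      rw [if_neg hn1] at hk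
      have : Nontrivial (Fin n) := Fin.nontrivial_iff_two_le.mpr (by omega)
      obtain ⟨j, hj⟩ := exists_ne i
      refine ⟨Sum.inr j, by simp [inr_mem_geodClosure_star, hj], ?_⟩
      rw [grundy_star_leaf_leaf hj.symm]
      omega

end Star

/-- the Grundy value of the Closed Geodetic Game on the star `K_{1,n}`
is `1 - (n % 2)`. -/
theorem grundy_star (n : ℕ) (hn : 1 ≤ n) :
    grundy (completeBipartiteGraph (Fin 1) (Fin n)) (∅ : Finset (Fin 1 ⊕ Fin n)) =
      1 - n % 2 := by
  refine grundy_eq (fun v _ => ?_) fun k hk => ?_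
  · rcases v with a | i
    · obtain rfl := Subsingleton.elim 0 a
      rw [insert_empty_eq, grundy_star_center]
      omega
    · rw [insert_empty_eq, grundy_star_leaf]
      split_ifs <;> omega
  · refine ⟨Sum.inl 0, by simp [geodClosure], ?_⟩
    rw [insert_empty_eq, grundy_star_center]
    omega
end

section
/- For every nonnegative integer m, the Sprague–Grundy value of the Closed Geodetic Game position on the path P_{4m+2} with its (2m+1)-st vertex u_{2m+1} already selected is 𝒢(P_{4m+2}, {u_{2m+1}}) = 1. -/
open SimpleGraph

/-- A set containing every number below `k` but not `k` itself has mex `k`. -/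
theorem mex_eq_of_forall_lt {X : Set ℕ} {k : ℕ} (hk : k ∉ X) (h : ∀ j < k, j ∈ X) :
    mex X = k :=
  le_antisymm (Nat.sInf_le hk)
    (le_csInf ⟨k, hk⟩ fun j hj => not_lt.1 fun hlt => hj (h j hlt))

theorem exists_pathGraph_walk_length {n : ℕ} (d : ℕ) :
    ∀ u v : Fin n, u.val + d = v.val → ∃ p : (pathGraph n).Walk u v, p.length = d := by
  induction d with
  | zero =>
    intro u v h
    obtain rfl : u = v := Fin.ext h
    exact ⟨.nil, rfl⟩
  | succ d ih =>
    intro u v h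
    obtain ⟨p, hp⟩ := ih ⟨u + 1, by omega⟩ v (by simp only; omega)
    exact ⟨.cons (pathGraph_adj.2 (Or.inl rfl)) p, by simp [hp]⟩

theorem pathGraph_walk_le_length {n : ℕ} {u v : Fin n} (p : (pathGraph n).Walk u v) :
    v.val ≤ u.val + p.length := by
  induction p with
  | nil => simp
  | cons h p ih =>
    rw [pathGraph_adj] at h
    rw [Walk.length_cons]
    omega

theorem pathGraph_dist_of_le {n : ℕ} {u v : Fin n} (h : u ≤ v) :
    (pathGraph n).dist u v = v.val - u.val := by
  have h' : u.val ≤ v.val := h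
  obtain ⟨p, hp⟩ := exists_pathGraph_walk_length (v.val - u.val) u v (by omega)
  obtain ⟨q, hq⟩ := (pathGraph_preconnected n u v).exists_walk_length_eq_dist
  have := pathGraph_walk_le_length q
  have := dist_le p
  omega

theorem pathGraph_dist {n : ℕ} (u v : Fin n) :
    (pathGraph n).dist u v = (v.val - u.val) + (u.val - v.val) := by
  rcases le_total u v with h | h
  · rw [pathGraph_dist_of_le h]
    have : u.val ≤ v.val := h
    omega
  · rw [dist_comm, pathGraph_dist_of_le h]
    have : v.val ≤ u.val := h
    omega

/-- On a path, the geodetic closure of a set is the span between its extreme vertices. -/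
theorem geodClosure_pathGraph {n : ℕ} {S : Set (Fin n)} {a b : Fin n} (ha : IsLeast S a)
    (hb : IsGreatest S b) : geodClosure (pathGraph n) S = Set.Icc a b := by
  ext w
  simp only [geodClosure, geodInterval, Set.mem_iUnion, Set.mem_ofPred_eq, Set.mem_Icc,
    pathGraph_dist, exists_prop, Fin.le_def]
  constructor
  · rintro ⟨u, hu, v, hv, h⟩
    have hau : a.val ≤ u.val := ha.2 hu
    have hav : a.val ≤ v.val := ha.2 hv
    have hub : u.val ≤ b.val := hb.2 hu
    have hvb : v.val ≤ b.val := hb.2 hv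
    omega
  · rintro ⟨haw, hwb⟩
    exact ⟨a, ha.1, b, hb.1, by omega⟩

/-- A position on a path with extreme selected vertices `a ≤ b` is a two-heap Nim position, the
heaps being the vertices to the left of `a` and to the right of `b`. -/
theorem grundy_pathGraph {n : ℕ} {S : Finset (Fin n)} {a b : Fin n}
    (ha : IsLeast (S : Set (Fin n)) a) (hb : IsGreatest (S : Set (Fin n)) b) :
    grundy (pathGraph n) S = a.val ^^^ (n - 1 - b.val) := by
  have hab : a ≤ b := ha.2 hb.1
  have left (v : Fin n) (hv : v < a) :
      grundy (pathGraph n) (insert v S) = v.val ^^^ (n - 1 - b.val) := by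
    apply grundy_pathGraph
    · simpa [hv.le] using ha.insert v
    · simpa [(hv.le.trans hab)] using hb.insert v
  have right (v : Fin n) (hv : b < v) :
      grundy (pathGraph n) (insert v S) = a.val ^^^ (n - 1 - v.val) := by
    apply grundy_pathGraph
    · simpa [(hab.trans hv.le)] using ha.insert v
    · simpa [hv.le] using hb.insert v
  rw [grundy]
  apply mex_eq_of_forall_lt
  · rintro ⟨⟨v, hv⟩, h⟩
    rw [geodClosure_pathGraph ha hb, Set.mem_Icc, not_and_or, not_le, not_le] at hv
    rcases hv with hv | hv
    · simp only [left v hv, Nat.xor_left_inj] at h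
      exact hv.ne (Fin.ext h)
    · simp only [right v hv, Nat.xor_right_inj] at h
      have : b.val < v.val := hv
      omega
  · intro j hj
    rcases Nat.lt_xor_cases hj with h | h
    · have hv : (⟨j ^^^ (n - 1 - b.val), h.trans a.2⟩ : Fin n) < a := h
      refine ⟨⟨_, ?_⟩, (left _ hv).trans (Nat.xor_xor_cancel_right _ _)⟩
      rw [geodClosure_pathGraph ha hb]
      exact fun hm => hm.1.not_gt hv
    · have hv : b < (⟨n - 1 - (j ^^^ a.val), by omega⟩ : Fin n) := by
        rw [Fin.lt_def]
        simp only
        omega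
      refine ⟨⟨_, ?_⟩, (right _ hv).trans ?_⟩
      · rw [geodClosure_pathGraph ha hb]
        exact fun hm => hm.2.not_gt hv
      · rw [show n - 1 - (n - 1 - (j ^^^ a.val)) = j ^^^ a.val by omega, Nat.xor_comm,
          Nat.xor_xor_cancel_right]
termination_by a.val + (n - 1 - b.val)
decreasing_by
  all_goals
    have := Fin.lt_def.1 hv
    omega

/-- on the path `P_{4m+2}` with vertices `u_1, …, u_{4m+2}`, the Grundy
value of the Closed Geodetic Game position with the `(2m+1)`-st vertex selected is `1`. -/
theorem grundy_path_middle (m : ℕ) :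
    grundy (SimpleGraph.pathGraph (4 * m + 2))
      ({⟨2 * m, by omega⟩} : Finset (Fin (4 * m + 2))) = 1 := by
  rw [grundy_pathGraph (a := ⟨2 * m, by omega⟩) (b := ⟨2 * m, by omega⟩) (by simp) (by simp)]
  have h : 4 * m + 2 - 1 - 2 * m = 2 * m ^^^ 1 := by
    rw [Nat.xor_one_of_even (even_two_mul m)]
    omega
  simp only [h, Nat.xor_xor_cancel_left]
end
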